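/- arXiv:math/0512247 — 5 statements merged into one kernel-verified Lean document; each statement's English description precedes it below -/
import Mathlib

section
/- Let (F^•, E^•, I^•, Ψ) be a homological spark complex and let k ≥ 0. Then: (i) if two sparks (a,r) and (a′,r′) of degree k are equivalent, the unique elements e, e′ ∈ E^{k+1} with da = e − Ψ(r) and da′ = e′ − Ψ(r′) are equal; (ii) for every spark (a,r) of degree k, the element e lies in Z_I^{k+1}(E); (iii) the induced map δ₁ : Ĥ^k → Z_I^{k+1}(E), sending the class of (a,r) to e, is a surjective group homomorphism. -/
universe u

/-- A homological spark complex: cochain complexes `F`, `E ⊆ F`, `I` (indexed by `ℤ`,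
trivial in negative degrees), a morphism `Ψ : I → F`, such that `Ψ(Iᵏ) ∩ Eᵏ = 0` for `k > 0`,
the inclusion `E ⊆ F` induces an isomorphism on cohomology, and `Ψ` is injective in degree 0. -/
structure SparkComplex where
  F : ℤ → Type u
  [instF : ∀ n, AddCommGroup (F n)]
  I : ℤ → Type u
  [instI : ∀ n, AddCommGroup (I n)]
  dF : ∀ n, F n →+ F (n + 1)
  dI : ∀ n, I n →+ I (n + 1)
  E : ∀ n, AddSubgroup (F n)
  Ψ : ∀ n, I n →+ F n
  F_neg : ∀ n < 0, Subsingleton (F n)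
  I_neg : ∀ n < 0, Subsingleton (I n)
  dF_sq : ∀ n (a : F n), dF (n + 1) (dF n a) = 0
  dI_sq : ∀ n (r : I n), dI (n + 1) (dI n r) = 0
  E_stable : ∀ n, ∀ a ∈ E n, dF n a ∈ E (n + 1)
  Ψ_comm : ∀ n (r : I n), dF n (Ψ n r) = Ψ (n + 1) (dI n r)
  disj : ∀ n, 0 < n → ∀ r : I n, Ψ n r ∈ E n → Ψ n r = 0
  psi0_inj : ∀ r : I 0, Ψ 0 r = 0 → r = 0
  h_surj : ∀ n (a : F (n + 1)), dF (n + 1) a = 0 →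
    ∃ e ∈ E (n + 1), ∃ b : F n, a = e + dF n b
  h_inj : ∀ n (e : F (n + 1)), e ∈ E (n + 1) → dF (n + 1) e = 0 →
    (∃ b : F n, e = dF n b) → ∃ c ∈ E n, e = dF n c

attribute [instance] SparkComplex.instF SparkComplex.instI

namespace SparkComplex

variable (S : SparkComplex)

/-- Transport along an equality of degrees, for `F`. -/
def fcast {m n : ℤ} (h : m = n) : S.F m →+ S.F n := by subst h; exact AddMonoidHom.id _

/-- Transport along an equality of degrees, for `I`. -/
def icast {m n : ℤ} (h : m = n) : S.I m →+ S.I n := by subst h; exact AddMonoidHom.id _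

/-- The differential of `F` written as a map `F^(k-1) → F^k`. -/
def dF' (k : ℤ) : S.F (k - 1) →+ S.F k := (S.fcast (by omega)).comp (S.dF (k - 1))

/-- The differential of `I` written as a map `I^(k-1) → I^k`. -/
def dI' (k : ℤ) : S.I (k - 1) →+ S.I k := (S.icast (by omega)).comp (S.dI (k - 1))

/-- A spark of degree `k` : a pair `(a, r) ∈ F^k ⊕ I^(k+1)` with `dr = 0` and
`da = e - Ψ(r)` for some `e ∈ E^(k+1)`. -/
def IsSpark (k : ℤ) (p : S.F k × S.I (k + 1)) : Prop :=
  S.dI (k + 1) p.2 = 0 ∧ ∃ e ∈ S.E (k + 1), S.dF k p.1 = e - S.Ψ (k + 1) p.2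

/-- Equivalence of sparks of degree `k`. -/
def SparkEquiv (k : ℤ) (p q : S.F k × S.I (k + 1)) : Prop :=
  ∃ (b : S.F (k - 1)) (s : S.I k),
    p.1 - q.1 = S.dF' k b + S.Ψ k s ∧ p.2 - q.2 = -S.dI k s

/-- The group of sparks of degree `k`. -/
def sparkGroup (k : ℤ) : AddSubgroup (S.F k × S.I (k + 1)) where
  carrier := {p | S.IsSpark k p}
  zero_mem' := by
    simp only [Set.mem_setOf_eq, IsSpark]
    exact ⟨by simp, 0, zero_mem _, by simp⟩
  add_mem' := by
    intro p q hp hq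
    simp only [Set.mem_setOf_eq, IsSpark] at hp hq ⊢
    obtain ⟨hp1, e, he, hpe⟩ := hp
    obtain ⟨hq1, e', he', hqe⟩ := hq
    refine ⟨?_, e + e', add_mem he he', ?_⟩
    · rw [Prod.snd_add, map_add, hp1, hq1, add_zero]
    · rw [Prod.fst_add, Prod.snd_add, map_add, map_add, hpe, hqe]; try abel
  neg_mem' := by
    intro p hp
    simp only [Set.mem_setOf_eq, IsSpark] at hp ⊢
    obtain ⟨hp1, e, he, hpe⟩ := hp
    refine ⟨?_, -e, neg_mem he, ?_⟩
    · rw [Prod.snd_neg, map_neg, hp1, neg_zero]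
    · rw [Prod.fst_neg, Prod.snd_neg, map_neg, map_neg, hpe]; try abel

/-- The group of sparks equivalent to zero. -/
def trivGroup (k : ℤ) : AddSubgroup (S.F k × S.I (k + 1)) where
  carrier := {p | ∃ (b : S.F (k - 1)) (s : S.I k),
    p.1 = S.dF' k b + S.Ψ k s ∧ p.2 = -S.dI k s}
  zero_mem' := by
    simp only [Set.mem_setOf_eq]
    exact ⟨0, 0, by simp, by simp⟩
  add_mem' := by
    intro p q hp hq
    simp only [Set.mem_setOf_eq] at hp hq ⊢
    obtain ⟨b, s, h1, h2⟩ := hp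
    obtain ⟨b', s', h1', h2'⟩ := hq
    refine ⟨b + b', s + s', ?_, ?_⟩
    · rw [Prod.fst_add, map_add, map_add, h1, h1']; try abel
    · rw [Prod.snd_add, map_add, h2, h2']; try abel
  neg_mem' := by
    intro p hp
    simp only [Set.mem_setOf_eq] at hp ⊢
    obtain ⟨b, s, h1, h2⟩ := hp
    refine ⟨-b, -s, ?_, ?_⟩
    · rw [Prod.fst_neg, map_neg, map_neg, h1]; try abel
    · rw [Prod.snd_neg, map_neg, h2]; try abel

/-- The group `Ĥᵏ` of spark classes of degree `k`. -/
def hhat (k : ℤ) : Type u :=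
  ↥(S.sparkGroup k) ⧸ (S.trivGroup k).addSubgroupOf (S.sparkGroup k)

instance (k : ℤ) : AddCommGroup (S.hhat k) :=
  inferInstanceAs (AddCommGroup
    (↥(S.sparkGroup k) ⧸ (S.trivGroup k).addSubgroupOf (S.sparkGroup k)))

/-- The spark class of a spark. -/
def mkSpark (k : ℤ) (p : S.F k × S.I (k + 1)) (h : S.IsSpark k p) : S.hhat k :=
  QuotientAddGroup.mk (⟨p, h⟩ : ↥(S.sparkGroup k))

/-- Cocycles of `I`. -/
def zI (k : ℤ) : AddSubgroup (S.I k) where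
  carrier := {r | S.dI k r = 0}
  zero_mem' := by simp
  add_mem' := by
    intro a b ha hb
    simp only [Set.mem_setOf_eq] at ha hb ⊢
    rw [map_add, ha, hb, add_zero]
  neg_mem' := by
    intro a ha
    simp only [Set.mem_setOf_eq] at ha ⊢
    rw [map_neg, ha, neg_zero]

/-- Coboundaries of `I`. -/
def bI (k : ℤ) : AddSubgroup (S.I k) := (S.dI' k).range

/-- Cohomology of `I`. -/
def HI (k : ℤ) : Type u := ↥(S.zI k) ⧸ (S.bI k).addSubgroupOf (S.zI k)

instance (k : ℤ) : AddCommGroup (S.HI k) :=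
  inferInstanceAs (AddCommGroup (↥(S.zI k) ⧸ (S.bI k).addSubgroupOf (S.zI k)))

/-- The cohomology class of a cocycle of `I`. -/
def mkHI (k : ℤ) (r : S.I k) (h : S.dI k r = 0) : S.HI k :=
  QuotientAddGroup.mk (⟨r, h⟩ : ↥(S.zI k))

/-- Cocycles of `F`. -/
def zF (k : ℤ) : AddSubgroup (S.F k) where
  carrier := {a | S.dF k a = 0}
  zero_mem' := by simp
  add_mem' := by
    intro a b ha hb
    simp only [Set.mem_setOf_eq] at ha hb ⊢
    rw [map_add, ha, hb, add_zero]
  neg_mem' := by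
    intro a ha
    simp only [Set.mem_setOf_eq] at ha ⊢
    rw [map_neg, ha, neg_zero]

/-- Coboundaries of `F`. -/
def bF (k : ℤ) : AddSubgroup (S.F k) := (S.dF' k).range

/-- Cohomology of `F`. -/
def HF (k : ℤ) : Type u := ↥(S.zF k) ⧸ (S.bF k).addSubgroupOf (S.zF k)

instance (k : ℤ) : AddCommGroup (S.HF k) :=
  inferInstanceAs (AddCommGroup (↥(S.zF k) ⧸ (S.bF k).addSubgroupOf (S.zF k)))

/-- The cohomology class of a cocycle of `F`. -/
def mkHF (k : ℤ) (a : S.F k) (h : S.dF k a = 0) : S.HF k :=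
  QuotientAddGroup.mk (⟨a, h⟩ : ↥(S.zF k))

/-- The group `Z_I^k(E)` of `d`-closed elements of `E^k` whose cohomology class (in
`H^k(E) ≅ H^k(F)`) lies in the image of `Ψ_* : H^k(I) → H^k(F)`. -/
def ZIE (k : ℤ) : AddSubgroup (S.F k) where
  carrier := {e | e ∈ S.E k ∧ S.dF k e = 0 ∧
    ∃ r : S.I k, S.dI k r = 0 ∧ ∃ b : S.F (k - 1), e - S.Ψ k r = S.dF' k b}
  zero_mem' := by
    simp only [Set.mem_setOf_eq]
    refine ⟨zero_mem _, map_zero _, 0, map_zero _, 0, by simp⟩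
  add_mem' := by
    intro a b ha hb
    simp only [Set.mem_setOf_eq] at ha hb ⊢
    obtain ⟨haE, had, r, hr, c, hc⟩ := ha
    obtain ⟨hbE, hbd, r', hr', c', hc'⟩ := hb
    refine ⟨add_mem haE hbE, by rw [map_add, had, hbd, add_zero], r + r',
      by rw [map_add, hr, hr', add_zero], c + c', ?_⟩
    rw [map_add, map_add, ← hc, ← hc']
    abel
  neg_mem' := by
    intro a ha
    simp only [Set.mem_setOf_eq] at ha ⊢
    obtain ⟨haE, had, r, hr, c, hc⟩ := ha
    refine ⟨neg_mem haE, by rw [map_neg, had, neg_zero], -r,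
      by rw [map_neg, hr, neg_zero], -c, ?_⟩
    rw [map_neg, map_neg, ← hc]
    abel

/-- The differential of the cone complex `G^k = F^k ⊕ I^(k+1)`,
`D(a,r) = (da + Ψ(r), -dr)`. -/
def coneD (k : ℤ) : (S.F k × S.I (k + 1)) →+ (S.F (k + 1) × S.I (k + 1 + 1)) :=
  AddMonoidHom.mk' (fun p => (S.dF k p.1 + S.Ψ (k + 1) p.2, -(S.dI (k + 1) p.2)))
    (by
      intro p q
      simp only [Prod.fst_add, Prod.snd_add, map_add, Prod.mk_add_mk, Prod.mk.injEq]
      exact ⟨by abel, by abel⟩)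

/-- Transport along an equality of degrees, for the cone complex. -/
def gcast {m n : ℤ} (h : m = n) : (S.F m × S.I (m + 1)) →+ (S.F n × S.I (n + 1)) := by
  subst h; exact AddMonoidHom.id _

/-- The cone differential written as a map `G^(k-1) → G^k`. -/
def coneD' (k : ℤ) : (S.F (k - 1) × S.I (k - 1 + 1)) →+ (S.F k × S.I (k + 1)) :=
  (S.gcast (by omega)).comp (S.coneD (k - 1))

/-- Cocycles of the cone complex. -/
def zG (k : ℤ) : AddSubgroup (S.F k × S.I (k + 1)) where
  carrier := {p | S.coneD k p = 0}
  zero_mem' := by simp only [Set.mem_setOf_eq, map_zero]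
  add_mem' := by
    intro p q hp hq
    simp only [Set.mem_setOf_eq] at hp hq ⊢
    rw [map_add, hp, hq, add_zero]
  neg_mem' := by
    intro p hp
    simp only [Set.mem_setOf_eq] at hp ⊢
    rw [map_neg, hp, neg_zero]

/-- Coboundaries of the cone complex. -/
def bG (k : ℤ) : AddSubgroup (S.F k × S.I (k + 1)) := (S.coneD' k).range

/-- Cohomology `H^k(G)` of the cone complex. -/
def HG (k : ℤ) : Type u := ↥(S.zG k) ⧸ (S.bG k).addSubgroupOf (S.zG k)

instance (k : ℤ) : AddCommGroup (S.HG k) :=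
  inferInstanceAs (AddCommGroup (↥(S.zG k) ⧸ (S.bG k).addSubgroupOf (S.zG k)))

/-- The cohomology class of a cocycle of the cone complex. -/
def mkHG (k : ℤ) (p : S.F k × S.I (k + 1)) (h : S.coneD k p = 0) : S.HG k :=
  QuotientAddGroup.mk (⟨p, h⟩ : ↥(S.zG k))

/-- Cocycles of `E`. -/
def zE (k : ℤ) : AddSubgroup (S.F k) where
  carrier := {a | a ∈ S.E k ∧ S.dF k a = 0}
  zero_mem' := by
    simp only [Set.mem_setOf_eq]
    exact ⟨zero_mem _, map_zero _⟩
  add_mem' := by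
    intro a b ha hb
    simp only [Set.mem_setOf_eq] at ha hb ⊢
    exact ⟨add_mem ha.1 hb.1, by rw [map_add, ha.2, hb.2, add_zero]⟩
  neg_mem' := by
    intro a ha
    simp only [Set.mem_setOf_eq] at ha ⊢
    exact ⟨neg_mem ha.1, by rw [map_neg, ha.2, neg_zero]⟩

/-- Coboundaries of `E`. -/
def bE (k : ℤ) : AddSubgroup (S.F k) := AddSubgroup.map (S.dF' k) (S.E (k - 1))

/-- Cohomology `H^k(E)` of `E`. -/
def HE (k : ℤ) : Type u := ↥(S.zE k) ⧸ (S.bE k).addSubgroupOf (S.zE k)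

instance (k : ℤ) : AddCommGroup (S.HE k) :=
  inferInstanceAs (AddCommGroup (↥(S.zE k) ⧸ (S.bE k).addSubgroupOf (S.zE k)))

/-- The image `H^k_I(E)` of `Ψ_* : H^k(I) → H^k(E)` in `H^k(E)`. -/
def HIE (k : ℤ) : AddSubgroup (S.HE k) :=
  AddSubgroup.map (QuotientAddGroup.mk' ((S.bE k).addSubgroupOf (S.zE k)))
    ((S.ZIE k).addSubgroupOf (S.zE k))

/-- The subgroup `dE^k ⊆ F^(k+1)`. -/
def dimE (k : ℤ) : AddSubgroup (S.F (k + 1)) := AddSubgroup.map (S.dF k) (S.E k)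

end SparkComplex

namespace SparkComplex

variable (S : SparkComplex)

theorem fcast_dF {m n : ℤ} (h : m = n) (h' : m + 1 = n + 1) (a : S.F m) :
    S.fcast h' (S.dF m a) = S.dF n (S.fcast h a) := by
  subst h
  rfl

theorem fcast_fcast_symm {m n : ℤ} (h : m = n) (a : S.F n) :
    S.fcast h (S.fcast h.symm a) = a := by
  subst h
  rfl

theorem exists_dF'_eq_iff (k : ℤ) (x : S.F (k + 1)) :
    (∃ b : S.F (k + 1 - 1), x = S.dF' (k + 1) b) ↔ ∃ a : S.F k, x = S.dF k a := by
  have h : k + 1 - 1 = k := by omega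
  have key : ∀ b, S.dF' (k + 1) b = S.dF k (S.fcast h b) := fun b =>
    S.fcast_dF h (by omega) b
  constructor
  · rintro ⟨b, rfl⟩
    exact ⟨_, key b⟩
  · rintro ⟨a, rfl⟩
    exact ⟨S.fcast h.symm a, by rw [key, fcast_fcast_symm]⟩

theorem dF_fcast_of_cocycle {m n : ℤ} (h : m = n) (a : S.F m) (ha : S.dF m a = 0) :
    S.dF n (S.fcast h a) = 0 := by
  subst h
  exact ha

theorem dF_dF' (k : ℤ) (b : S.F (k - 1)) : S.dF k (S.dF' k b) = 0 :=
  S.dF_fcast_of_cocycle (by omega) _ (S.dF_sq _ b)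

/-- The smooth part `da + Ψ(r)` of a pair `(a, r)`. -/
def smoothPart (k : ℤ) : (S.F k × S.I (k + 1)) →+ S.F (k + 1) :=
  (S.dF k).coprod (S.Ψ (k + 1))

theorem smoothPart_apply (k : ℤ) (p : S.F k × S.I (k + 1)) :
    S.smoothPart k p = S.dF k p.1 + S.Ψ (k + 1) p.2 := rfl

theorem smoothPart_eq_of_dF_eq {k : ℤ} {p : S.F k × S.I (k + 1)} {e : S.F (k + 1)}
    (h : S.dF k p.1 = e - S.Ψ (k + 1) p.2) : S.smoothPart k p = e := by
  rw [smoothPart_apply, h, sub_add_cancel]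

theorem smoothPart_eq_zero_of_mem_trivGroup {k : ℤ} {p : S.F k × S.I (k + 1)}
    (hp : p ∈ S.trivGroup k) : S.smoothPart k p = 0 := by
  obtain ⟨b, s, h₁, h₂⟩ := hp
  rw [smoothPart_apply, h₁, h₂, map_add, dF_dF', S.Ψ_comm, map_neg, zero_add, add_neg_cancel]

theorem smoothPart_mem_ZIE {k : ℤ} {p : S.F k × S.I (k + 1)} (hp : S.IsSpark k p) :
    S.smoothPart k p ∈ S.ZIE (k + 1) := by
  obtain ⟨hr, e, he, hpe⟩ := hp
  refine ⟨by rwa [S.smoothPart_eq_of_dF_eq hpe], ?_, p.2, hr, ?_⟩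
  · rw [smoothPart_apply, map_add, S.dF_sq, S.Ψ_comm, hr, map_zero, add_zero]
  · rw [exists_dF'_eq_iff]
    exact ⟨p.1, by rw [smoothPart_apply, add_sub_cancel_right]⟩

/-- The homomorphism `δ₁ : Ĥ^k → Z_I^(k+1)(E)` sending a spark class to its smooth part. -/
def deltaOne (k : ℤ) : S.hhat k →+ S.ZIE (k + 1) :=
  QuotientAddGroup.lift _
    (((S.smoothPart k).comp (S.sparkGroup k).subtype).codRestrict (S.ZIE (k + 1))
      fun p => S.smoothPart_mem_ZIE p.2)
    fun _ hp => Subtype.ext (S.smoothPart_eq_zero_of_mem_trivGroup hp)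

theorem coe_deltaOne_mkSpark (k : ℤ) (p : S.F k × S.I (k + 1)) (hp : S.IsSpark k p) :
    (S.deltaOne k (S.mkSpark k p hp) : S.F (k + 1)) = S.smoothPart k p := rfl

theorem deltaOne_surjective (k : ℤ) : Function.Surjective (S.deltaOne k) := by
  rintro ⟨e, he, hde, r, hr, hb⟩
  obtain ⟨a, ha⟩ := (S.exists_dF'_eq_iff k _).1 hb
  exact ⟨S.mkSpark k (a, r) ⟨hr, e, he, ha.symm⟩,
    Subtype.ext (S.smoothPart_eq_of_dF_eq (p := (a, r)) ha.symm)⟩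

end SparkComplex

/-- (i) equivalent sparks have the same smooth part `e`;
(ii) the smooth part of a spark lies in `Z_I^(k+1)(E)`;
(iii) the induced map `δ₁ : Ĥ^k → Z_I^(k+1)(E)` is a surjective group homomorphism. -/
theorem delta_one (S : SparkComplex) (k : ℤ) (hk : 0 ≤ k) :
    (∀ (p q : S.F k × S.I (k + 1)), S.IsSpark k p → S.IsSpark k q →
      ∀ e e' : S.F (k + 1), e ∈ S.E (k + 1) → e' ∈ S.E (k + 1) →
      S.dF k p.1 = e - S.Ψ (k + 1) p.2 → S.dF k q.1 = e' - S.Ψ (k + 1) q.2 →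
      S.SparkEquiv k p q → e = e') ∧
    (∀ p : S.F k × S.I (k + 1), S.IsSpark k p → ∀ e : S.F (k + 1),
      e ∈ S.E (k + 1) → S.dF k p.1 = e - S.Ψ (k + 1) p.2 → e ∈ S.ZIE (k + 1)) ∧
    (∃ δ₁ : S.hhat k →+ ↥(S.ZIE (k + 1)),
      (∀ (p : S.F k × S.I (k + 1)) (hp : S.IsSpark k p) (e : S.F (k + 1)),
        e ∈ S.E (k + 1) → S.dF k p.1 = e - S.Ψ (k + 1) p.2 →
        ((δ₁ (S.mkSpark k p hp) : S.F (k + 1)) = e)) ∧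
      Function.Surjective δ₁) := by
  refine ⟨?_, ?_, S.deltaOne k, ?_, S.deltaOne_surjective k⟩
  · intro p q _ _ e e' _ _ hp hq hpq
    have h : S.smoothPart k (p - q) = 0 := S.smoothPart_eq_zero_of_mem_trivGroup hpq
    rwa [map_sub, S.smoothPart_eq_of_dF_eq hp, S.smoothPart_eq_of_dF_eq hq, sub_eq_zero] at h
  · intro p hp e _ hpe
    exact S.smoothPart_eq_of_dF_eq hpe ▸ S.smoothPart_mem_ZIE hp
  · intro p hp e _ hpe
    rw [S.coe_deltaOne_mkSpark, S.smoothPart_eq_of_dF_eq hpe]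
end

section
/- Let (F^•, E^•, I^•, Ψ) be a homological spark complex and let k ≥ 0. Then: (i) if two sparks (a,r) and (a′,r′) of degree k are equivalent, then r and r′ are cohomologous cocycles of I^•; (ii) the induced map δ₂ : Ĥ^k → H^{k+1}(I), sending the class of a spark (a,r) to the cohomology class of r, is a surjective group homomorphism. -/
universe u

namespace SparkComplex

theorem exists_icast_dI_eq (S : SparkComplex) {m k : ℤ} (hm : m = k) (h : m + 1 = k + 1)
    (s : S.I k) : ∃ x : S.I m, S.icast h (S.dI m x) = S.dI k s := by
  subst hm
  exact ⟨s, rfl⟩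

theorem dI_mem_bI (S : SparkComplex) (k : ℤ) (s : S.I k) : S.dI k s ∈ S.bI (k + 1) :=
  S.exists_icast_dI_eq (by omega) (by omega) s

/-- The projection of a spark `(a, r)` to the cocycle `r`. -/
def sparkToCocycle (S : SparkComplex) (k : ℤ) : S.sparkGroup k →+ S.zI (k + 1) where
  toFun p := ⟨p.1.2, p.2.1⟩
  map_zero' := rfl
  map_add' _ _ := rfl

theorem trivGroup_le_comap_sparkToCocycle (S : SparkComplex) (k : ℤ) :
    (S.trivGroup k).addSubgroupOf (S.sparkGroup k) ≤
      ((S.bI (k + 1)).addSubgroupOf (S.zI (k + 1))).comap (S.sparkToCocycle k) := by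
  rintro ⟨p, hp⟩ ⟨b, s, -, hs⟩
  change p.2 ∈ S.bI (k + 1)
  change p.2 = -S.dI k s at hs
  rw [hs]
  exact neg_mem (S.dI_mem_bI k s)

/-- The map `δ₂` sending the class of a spark `(a, r)` to the cohomology class of `r`. -/
def sparkClassToHI (S : SparkComplex) (k : ℤ) : S.hhat k →+ S.HI (k + 1) :=
  QuotientAddGroup.map _ _ (S.sparkToCocycle k) (S.trivGroup_le_comap_sparkToCocycle k)

/-- Every cocycle `r` of `I` is the second component of a spark. -/
theorem exists_isSpark (S : SparkComplex) (k : ℤ) (r : S.I (k + 1))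
    (hr : S.dI (k + 1) r = 0) : ∃ a : S.F k, S.IsSpark k (a, r) := by
  obtain ⟨e, he, b, hb⟩ := S.h_surj k (S.Ψ (k + 1) r) (by rw [S.Ψ_comm, hr, map_zero])
  refine ⟨-b, hr, e, he, ?_⟩
  change S.dF k (-b) = e - S.Ψ (k + 1) r
  rw [hb, map_neg]
  abel

theorem sparkClassToHI_surjective (S : SparkComplex) (k : ℤ) :
    Function.Surjective (S.sparkClassToHI k) := by
  intro x
  obtain ⟨⟨r, hr⟩, rfl⟩ := QuotientAddGroup.mk_surjective x
  obtain ⟨a, ha⟩ := S.exists_isSpark k r hr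
  exact ⟨S.mkSpark k (a, r) ha, rfl⟩

end SparkComplex

/-- (i) equivalent sparks have cohomologous underlying cocycles in `I`;
(ii) the induced map `δ₂ : Ĥ^k → H^(k+1)(I)` is a surjective group homomorphism. -/
theorem delta_two (S : SparkComplex) (k : ℤ) (hk : 0 ≤ k) :
    (∀ p q : S.F k × S.I (k + 1), S.IsSpark k p → S.IsSpark k q →
      S.SparkEquiv k p q →
      S.dI (k + 1) p.2 = 0 ∧ S.dI (k + 1) q.2 = 0 ∧
        ∃ s : S.I k, p.2 - q.2 = S.dI k s) ∧
    (∃ δ₂ : S.hhat k →+ S.HI (k + 1),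
      (∀ (p : S.F k × S.I (k + 1)) (hp : S.IsSpark k p) (h : S.dI (k + 1) p.2 = 0),
        δ₂ (S.mkSpark k p hp) = S.mkHI (k + 1) p.2 h) ∧
      Function.Surjective δ₂) := by
  refine ⟨?_, S.sparkClassToHI k, fun p hp h => rfl, S.sparkClassToHI_surjective k⟩
  rintro p q hp hq ⟨b, s, -, hs⟩
  exact ⟨hp.1, hq.1, -s, by rw [hs, map_neg]⟩
end

section
/- Let (F^•, E^•, I^•, Ψ) be a homological spark complex, k ≥ 0, and let Ĥ^k_E := ker(δ₂ : Ĥ^k → H^{k+1}(I)). Then every class in Ĥ^k_E is represented by a spark of the form (a, 0) with a ∈ E^k, and the assignment a ↦ class of (a,0) induces a group isomorphism E^k / Z_I^k(E) ≅ Ĥ^k_E. -/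
universe u

namespace SparkComplex

variable (S : SparkComplex)

theorem icast_dI {m n : ℤ} (h : m = n) (h' : m + 1 = n + 1) (r : S.I m) :
    S.icast h' (S.dI m r) = S.dI n (S.icast h r) := by
  subst h; rfl

theorem fcast_surjective {m n : ℤ} (h : m = n) : Function.Surjective (S.fcast h) := by
  subst h; exact fun a => ⟨a, rfl⟩

theorem icast_surjective {m n : ℤ} (h : m = n) : Function.Surjective (S.icast h) := by
  subst h; exact fun r => ⟨r, rfl⟩

theorem mem_bI_succ {k : ℤ} {r : S.I (k + 1)} :
    r ∈ S.bI (k + 1) ↔ ∃ s : S.I k, r = S.dI k s := by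
  have h : k + 1 - 1 = k := by omega
  constructor
  · rintro ⟨t, rfl⟩
    exact ⟨S.icast h t, S.icast_dI h _ t⟩
  · rintro ⟨s, rfl⟩
    obtain ⟨t, rfl⟩ := S.icast_surjective h s
    exact ⟨t, S.icast_dI h _ t⟩

theorem exists_dF'_succ_eq {n : ℤ} (b : S.F n) : ∃ c, S.dF' (n + 1) c = S.dF n b := by
  have h : n + 1 - 1 = n := by omega
  obtain ⟨t, rfl⟩ := S.fcast_surjective h b
  exact ⟨t, S.fcast_dF h _ t⟩

/-- A cochain of `F` whose differential lies in `E` differs from a cochain of `E` by a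
coboundary. -/
theorem exists_mem_E_add_coboundary {k : ℤ} (a : S.F k) (ha : S.dF k a ∈ S.E (k + 1)) :
    ∃ c ∈ S.E k, ∃ b, a = c + S.dF' k b := by
  obtain ⟨c, hc, hac⟩ := S.h_inj k _ ha (S.dF_sq k a) ⟨a, rfl⟩
  obtain ⟨n, rfl⟩ : ∃ n, k = n + 1 := ⟨k - 1, by omega⟩
  obtain ⟨e, he, b, hb⟩ := S.h_surj n (a - c) (by rw [map_sub, hac, sub_self])
  obtain ⟨b', hb'⟩ := S.exists_dF'_succ_eq b
  exact ⟨c + e, add_mem hc he, b', by rw [hb', add_assoc, ← hb]; abel⟩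

theorem isSpark_of_mem_E {k : ℤ} {a : S.F k} (ha : a ∈ S.E k) : S.IsSpark k (a, 0) :=
  ⟨map_zero _, S.dF k a, S.E_stable k a ha, by simp⟩

theorem mkSpark_eq_iff {k : ℤ} {p q : S.F k × S.I (k + 1)} (hp : S.IsSpark k p)
    (hq : S.IsSpark k q) : S.mkSpark k p hp = S.mkSpark k q hq ↔ S.SparkEquiv k p q := by
  refine (eq_comm.trans QuotientAddGroup.eq).trans ?_
  have : -q + p = p - q := by abel
  change -q + p ∈ S.trivGroup k ↔ _
  rw [this]
  rfl

theorem mkHI_eq_zero_iff {k : ℤ} {r : S.I k} (h : S.dI k r = 0) :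
    S.mkHI k r h = 0 ↔ r ∈ S.bI k :=
  QuotientAddGroup.eq_zero_iff _

/-- The map `Ĥᵏ → H^(k+1)(I)` sending the class of `(a, r)` to the class of `r`. -/
def delta₂ (k : ℤ) : S.hhat k →+ S.HI (k + 1) :=
  QuotientAddGroup.map _ _
    (((AddMonoidHom.snd (S.F k) (S.I (k + 1))).comp (S.sparkGroup k).subtype).codRestrict
      (S.zI (k + 1)) fun p => p.2.1)
    (by
      rintro p ⟨b, s, -, h⟩
      exact S.mem_bI_succ.2 ⟨-s, by rw [map_neg]; exact h⟩)

theorem delta₂_mkSpark {k : ℤ} (p : S.F k × S.I (k + 1)) (hp : S.IsSpark k p)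
    (h : S.dI (k + 1) p.2 = 0) : S.delta₂ k (S.mkSpark k p hp) = S.mkHI (k + 1) p.2 h :=
  rfl

theorem exists_eq_mkSpark_of_delta₂_eq_zero {k : ℤ} (x : S.hhat k) (hx : S.delta₂ k x = 0) :
    ∃ (a : S.F k) (_ : a ∈ S.E k) (hs : S.IsSpark k (a, (0 : S.I (k + 1)))),
      x = S.mkSpark k (a, 0) hs := by
  obtain ⟨⟨⟨a, r⟩, hp⟩, rfl⟩ := QuotientAddGroup.mk_surjective x
  obtain ⟨s, rfl⟩ := S.mem_bI_succ.1 ((S.mkHI_eq_zero_iff hp.1).1 hx)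
  obtain ⟨-, e, he, hae⟩ := id hp
  have hd : S.dF k (a + S.Ψ k s) = e := by
    rw [map_add, S.Ψ_comm]
    exact eq_sub_iff_add_eq.1 hae
  obtain ⟨c, hc, b, hb⟩ := S.exists_mem_E_add_coboundary (a + S.Ψ k s) (hd ▸ he)
  refine ⟨c, hc, S.isSpark_of_mem_E hc, (S.mkSpark_eq_iff hp _).2 ⟨b, -s, ?_, by simp⟩⟩
  change a - c = _
  rw [eq_sub_of_add_eq hb, map_neg]
  abel

/-- The map `E^k → ker δ₂` sending `a` to the class of `(a, 0)`. -/
def sparkOfE (k : ℤ) : S.E k →+ (S.delta₂ k).ker where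
  toFun a := ⟨S.mkSpark k (a, 0) (S.isSpark_of_mem_E a.2),
    (S.mkHI_eq_zero_iff (map_zero _)).2 (zero_mem _)⟩
  map_zero' := rfl
  map_add' a b := Subtype.ext <| (S.mkSpark_eq_iff (p := ((a + b : S.E k), 0))
    (q := ((a : S.F k), 0) + ((b : S.F k), 0)) _
    (add_mem (S := AddSubgroup _) (s := S.sparkGroup k) (S.isSpark_of_mem_E a.2)
      (S.isSpark_of_mem_E b.2))).2 ⟨0, 0, by simp, by simp⟩

theorem sparkOfE_surjective (k : ℤ) : Function.Surjective (S.sparkOfE k) := by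
  rintro ⟨x, hx⟩
  obtain ⟨a, ha, hs, rfl⟩ := S.exists_eq_mkSpark_of_delta₂_eq_zero x hx
  exact ⟨⟨a, ha⟩, rfl⟩

theorem ker_sparkOfE (k : ℤ) : (S.sparkOfE k).ker = (S.ZIE k).addSubgroupOf (S.E k) := by
  ext ⟨a, ha⟩
  have h : (⟨a, ha⟩ : S.E k) ∈ (S.sparkOfE k).ker ↔ S.SparkEquiv k (a, 0) 0 :=
    Subtype.ext_iff.trans (S.mkSpark_eq_iff (S.isSpark_of_mem_E ha) (S.sparkGroup k).zero_mem)
  rw [h, AddSubgroup.mem_addSubgroupOf]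
  constructor
  · rintro ⟨b, s, hab, hs⟩
    have hs : S.dI k s = 0 := by simpa using hs
    have hab : a = S.dF' k b + S.Ψ k s := by simpa using hab
    refine ⟨ha, ?_, s, hs, b, sub_eq_of_eq_add hab⟩
    change S.dF k a = 0
    rw [hab, map_add, dF_dF', S.Ψ_comm, hs, map_zero, add_zero]
  · rintro ⟨-, -, r, hr, b, hb⟩
    exact ⟨b, r, by simpa using sub_eq_iff_eq_add.1 hb, by simp [hr]⟩

end SparkComplex

/-- every class in `Ĥ^k_E = ker δ₂` is represented by a spark `(a, 0)` with
`a ∈ E^k`, and `a ↦ [(a,0)]` induces an isomorphism `E^k / Z_I^k(E) ≅ Ĥ^k_E`. -/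
theorem hhat_E_iso (S : SparkComplex) (k : ℤ) (hk : 0 ≤ k) :
    ∃ δ₂ : S.hhat k →+ S.HI (k + 1),
      (∀ (p : S.F k × S.I (k + 1)) (hp : S.IsSpark k p) (h : S.dI (k + 1) p.2 = 0),
        δ₂ (S.mkSpark k p hp) = S.mkHI (k + 1) p.2 h) ∧
      (∀ x : S.hhat k, δ₂ x = 0 →
        ∃ (a : S.F k) (_ : a ∈ S.E k) (hs : S.IsSpark k (a, (0 : S.I (k + 1)))),
          x = S.mkSpark k (a, 0) hs) ∧
      ∃ θ : (↥(S.E k) ⧸ (S.ZIE k).addSubgroupOf (S.E k)) ≃+ ↥δ₂.ker,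
        ∀ (a : ↥(S.E k)) (hs : S.IsSpark k ((a : S.F k), (0 : S.I (k + 1)))),
          ((θ (QuotientAddGroup.mk a) : ↥δ₂.ker) : S.hhat k)
            = S.mkSpark k ((a : S.F k), 0) hs := by
  refine ⟨S.delta₂ k, S.delta₂_mkSpark, S.exists_eq_mkSpark_of_delta₂_eq_zero,
    (QuotientAddGroup.quotientAddEquivOfEq (S.ker_sparkOfE k).symm).trans
      (QuotientAddGroup.quotientKerEquivOfSurjective _ (S.sparkOfE_surjective k)), ?_⟩
  intro a hs
  rfl
end

section
/- Let (F^•, E^•, I^•, Ψ) and (F̄^•, Ē^•, Ī^•, Ψ̄) be quasi-isomorphic homological spark complexes, via an inclusion F^• ⊆ F̄^• with Ē^• = E^• and a chain map ψ : I^• → Ī^• satisfying Ψ̄ ∘ ψ = Ψ (composed with the inclusion F^• ⊆ F̄^•) and inducing an isomorphism ψ_* : H^*(I) → H^*(Ī). Then the map sending a spark (a, r) of the first complex to the spark (a, ψ(r)) of the second induces, for every degree k, a group isomorphism Ĥ^k(F^•, E^•, I^•) ≅ Ĥ^k(F̄^•, Ē^•, Ī^•) of the associated groups of spark classes. -/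
universe u

namespace SparkComplex

theorem exists_eq_dF'_iff (S : SparkComplex) (m : ℤ) (x : S.F (m + 1)) :
    (∃ b : S.F (m + 1 - 1), x = S.dF' (m + 1) b) ↔ ∃ b : S.F m, x = S.dF m b := by
  have key : ∀ (n : ℤ) (_ : n = m) (h : n + 1 = m + 1),
      (∃ b : S.F n, x = S.fcast h (S.dF n b)) ↔ ∃ b : S.F m, x = S.dF m b := by
    rintro n rfl h
    rfl
  exact key _ (by omega) (by omega)

theorem exists_eq_dI'_iff (S : SparkComplex) (m : ℤ) (x : S.I (m + 1)) :
    (∃ b : S.I (m + 1 - 1), x = S.dI' (m + 1) b) ↔ ∃ b : S.I m, x = S.dI m b := by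
  have key : ∀ (n : ℤ) (_ : n = m) (h : n + 1 = m + 1),
      (∃ b : S.I n, x = S.icast h (S.dI n b)) ↔ ∃ b : S.I m, x = S.dI m b := by
    rintro n rfl h
    rfl
  exact key _ (by omega) (by omega)

theorem mem_trivGroup_succ (S : SparkComplex) (m : ℤ) (p : S.F (m + 1) × S.I (m + 1 + 1)) :
    p ∈ S.trivGroup (m + 1) ↔ ∃ (b : S.F m) (s : S.I (m + 1)),
      p.1 = S.dF m b + S.Ψ (m + 1) s ∧ p.2 = -S.dI (m + 1) s := by
  constructor
  · rintro ⟨b, s, h1, h2⟩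
    obtain ⟨c, hc⟩ := (S.exists_eq_dF'_iff m _).1 ⟨b, rfl⟩
    exact ⟨c, s, by rw [h1, hc], h2⟩
  · rintro ⟨b, s, h1, h2⟩
    obtain ⟨c, hc⟩ := (S.exists_eq_dF'_iff m _).2 ⟨b, rfl⟩
    exact ⟨c, s, by rw [h1, hc], h2⟩

variable {S S' : SparkComplex}

/-- An inclusion `j : F → F'` that identifies `E` with `E'` is injective on cohomology. -/
theorem exists_eq_dF_of_map_eq_dF (j : ∀ n, S.F n →+ S'.F n)
    (hj_inj : ∀ n, Function.Injective (j n))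
    (hj_d : ∀ n (a : S.F n), j (n + 1) (S.dF n a) = S'.dF n (j n a))
    (hjE : ∀ n, ∀ a ∈ S.E n, j n a ∈ S'.E n)
    (hjE_surj : ∀ n, ∀ e' ∈ S'.E n, ∃ a ∈ S.E n, j n a = e')
    (n : ℤ) (x : S.F (n + 1)) (b' : S'.F n) (h : j (n + 1) x = S'.dF n b') :
    ∃ b : S.F n, x = S.dF n b := by
  have hx : S.dF (n + 1) x = 0 := by
    apply hj_inj
    rw [hj_d, h, S'.dF_sq, map_zero]
  obtain ⟨e, he, c, rfl⟩ := S.h_surj n x hx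
  have hje : j (n + 1) e = S'.dF n (b' - j n c) := by
    rw [map_sub, ← h, ← hj_d, map_add, add_sub_cancel_right]
  obtain ⟨e', he', h'⟩ := S'.h_inj n (j (n + 1) e) (hjE _ e he)
    (by rw [hje, S'.dF_sq]) ⟨_, hje⟩
  obtain ⟨f, -, rfl⟩ := hjE_surj n e' he'
  refine ⟨f + c, ?_⟩
  rw [map_add, hj_inj _ (h'.trans (hj_d n f).symm)]

/-- The homomorphism `(a, r) ↦ (j a, ψ r)` between groups of sparks. -/
def sparkMap (j : ∀ n, S.F n →+ S'.F n) (ψ : ∀ n, S.I n →+ S'.I n)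
    (hj_d : ∀ n (a : S.F n), j (n + 1) (S.dF n a) = S'.dF n (j n a))
    (hψ_d : ∀ n (r : S.I n), ψ (n + 1) (S.dI n r) = S'.dI n (ψ n r))
    (hjE : ∀ n, ∀ a ∈ S.E n, j n a ∈ S'.E n)
    (hΨ : ∀ n (r : S.I n), S'.Ψ n (ψ n r) = j n (S.Ψ n r)) (k : ℤ) :
    S.sparkGroup k →+ S'.sparkGroup k :=
  (((j k).prodMap (ψ (k + 1))).comp (S.sparkGroup k).subtype).codRestrict _ (by
    rintro ⟨⟨a, r⟩, hr, e, he, hd⟩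
    refine ⟨?_, j (k + 1) e, hjE _ e he, ?_⟩
    · change S'.dI (k + 1) (ψ (k + 1) r) = 0
      rw [← hψ_d, hr, map_zero]
    · change S'.dF k (j k a) = j (k + 1) e - S'.Ψ (k + 1) (ψ (k + 1) r)
      rw [← hj_d, hΨ, hd, map_sub])

end SparkComplex

/-- a quasi-isomorphism of homological spark complexes (an inclusion
`j : F ↪ F̄` restricting to an isomorphism `E ≅ Ē`, together with a chain map
`ψ : I → Ī` compatible with `Ψ` and inducing an isomorphism on cohomology) induces an
isomorphism `Ĥ^k(F,E,I) ≅ Ĥ^k(F̄,Ē,Ī)` of the groups of spark classes, in every degree. -/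
theorem quasi_isomorphism_spark_classes (S S' : SparkComplex)
    (j : ∀ n, S.F n →+ S'.F n) (ψ : ∀ n, S.I n →+ S'.I n)
    (hj_inj : ∀ n, Function.Injective (j n))
    (hj_d : ∀ n (a : S.F n), j (n + 1) (S.dF n a) = S'.dF n (j n a))
    (hψ_d : ∀ n (r : S.I n), ψ (n + 1) (S.dI n r) = S'.dI n (ψ n r))
    (hjE : ∀ n, ∀ a ∈ S.E n, j n a ∈ S'.E n)
    (hjE_surj : ∀ n, ∀ e' ∈ S'.E n, ∃ a ∈ S.E n, j n a = e')
    (hΨ : ∀ n (r : S.I n), S'.Ψ n (ψ n r) = j n (S.Ψ n r))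
    (hψ_surj : ∀ n (r' : S'.I n), S'.dI n r' = 0 →
      ∃ r : S.I n, S.dI n r = 0 ∧ ∃ s' : S'.I (n - 1), r' - ψ n r = S'.dI' n s')
    (hψ_inj : ∀ n (r : S.I n), S.dI n r = 0 →
      (∃ s' : S'.I (n - 1), ψ n r = S'.dI' n s') → ∃ s : S.I (n - 1), r = S.dI' n s)
    (k : ℤ) :
    ∃ θ : S.hhat k ≃+ S'.hhat k,
      ∀ (p : S.F k × S.I (k + 1)) (hp : S.IsSpark k p)
        (hp' : S'.IsSpark k (j k p.1, ψ (k + 1) p.2)),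
        θ (S.mkSpark k p hp) = S'.mkSpark k (j k p.1, ψ (k + 1) p.2) hp' := by
  obtain ⟨m, rfl⟩ : ∃ m, k = m + 1 := ⟨k - 1, by omega⟩
  have hψ_surj' : ∀ n (r' : S'.I (n + 1)), S'.dI (n + 1) r' = 0 →
      ∃ r : S.I (n + 1), S.dI (n + 1) r = 0 ∧
        ∃ s' : S'.I n, r' - ψ (n + 1) r = S'.dI n s' := by
    intro n r' hr'
    obtain ⟨r, hr, h⟩ := hψ_surj _ r' hr'
    exact ⟨r, hr, (S'.exists_eq_dI'_iff n _).1 h⟩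
  have hψ_inj' : ∀ n (r : S.I (n + 1)), S.dI (n + 1) r = 0 →
      ∀ s' : S'.I n, ψ (n + 1) r = S'.dI n s' → ∃ s : S.I n, r = S.dI n s :=
    fun n r hr s' h =>
      (S.exists_eq_dI'_iff n _).1 (hψ_inj _ r hr ((S'.exists_eq_dI'_iff n _).2 ⟨s', h⟩))
  have hF := SparkComplex.exists_eq_dF_of_map_eq_dF j hj_inj hj_d hjE hjE_surj
  let f := SparkComplex.sparkMap j ψ hj_d hψ_d hjE hΨ (m + 1)
  have hf : (S.trivGroup (m + 1)).addSubgroupOf (S.sparkGroup (m + 1)) ≤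
      ((S'.trivGroup (m + 1)).addSubgroupOf (S'.sparkGroup (m + 1))).comap f := by
    rintro ⟨⟨a, r⟩, hp⟩ ht
    obtain ⟨b, s, h1, h2⟩ := (S.mem_trivGroup_succ m _).1 ht
    refine (S'.mem_trivGroup_succ m _).2 ⟨j m b, ψ (m + 1) s, ?_, ?_⟩
    · change j (m + 1) a = _
      rw [← hj_d, hΨ, ← map_add]
      exact congrArg _ h1
    · change ψ (m + 1 + 1) r = _
      rw [← hψ_d, ← map_neg]
      exact congrArg _ h2
  let g : S.hhat (m + 1) →+ S'.hhat (m + 1) := QuotientAddGroup.map _ _ f hf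
  have hg : Function.Bijective g := by
    constructor
    · rw [injective_iff_map_eq_zero]
      intro x hx
      obtain ⟨⟨⟨a, r⟩, hp⟩, rfl⟩ := QuotientAddGroup.mk_surjective x
      have hx' : f ⟨(a, r), hp⟩ ∈
          (S'.trivGroup (m + 1)).addSubgroupOf (S'.sparkGroup (m + 1)) :=
        (QuotientAddGroup.eq_zero_iff _).1 hx
      obtain ⟨b', s', h1, h2⟩ := (S'.mem_trivGroup_succ m _).1 hx'
      change j (m + 1) a = _ at h1
      change ψ (m + 1 + 1) r = _ at h2
      obtain ⟨s, hs⟩ := hψ_inj' _ r hp.1 (-s') (by rw [h2, map_neg])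
      obtain ⟨t, ht, u', hu⟩ := hψ_surj' m (s' + ψ (m + 1) s) (by
        rw [map_add, ← hψ_d, ← hs, h2, add_neg_cancel])
      have hs' : s' = ψ (m + 1) (t - s) + S'.dI m u' := by
        rw [← hu, map_sub]; abel
      obtain ⟨b, hb⟩ := hF m (a - S.Ψ (m + 1) (t - s)) (b' + S'.Ψ m u') (by
        rw [map_sub, h1, hs', map_add (S'.Ψ (m + 1)), hΨ, map_add, S'.Ψ_comm]; abel)
      refine (QuotientAddGroup.eq_zero_iff _).2
        ((S.mem_trivGroup_succ m _).2 ⟨b, t - s, ?_, ?_⟩)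
      · exact sub_eq_iff_eq_add.1 hb
      · change r = _
        rw [map_sub, ht, hs, zero_sub, neg_neg]
    · intro y
      obtain ⟨⟨⟨a', r'⟩, hr', e', he', hd⟩, rfl⟩ := QuotientAddGroup.mk_surjective y
      change S'.dI (m + 1 + 1) r' = 0 at hr'
      change S'.dF (m + 1) a' = e' - S'.Ψ (m + 1 + 1) r' at hd
      obtain ⟨r, hr, s', hs'⟩ := hψ_surj' _ r' hr'
      obtain ⟨e, he, rfl⟩ := hjE_surj _ e' he'
      have hd' : j (m + 1 + 1) (e - S.Ψ (m + 1 + 1) r) =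
          S'.dF (m + 1) (a' + S'.Ψ (m + 1) s') := by
        rw [map_add, hd, S'.Ψ_comm, ← hs', map_sub (S'.Ψ _), hΨ, map_sub]; abel
      obtain ⟨a, ha⟩ := hF _ _ _ hd'
      obtain ⟨c', hc', b', hb'⟩ := S'.h_surj m (a' + S'.Ψ (m + 1) s' - j (m + 1) a) (by
        rw [map_sub, ← hd', ← hj_d, ha, sub_self])
      obtain ⟨c, hc, rfl⟩ := hjE_surj _ c' hc'
      refine ⟨S.mkSpark (m + 1) (a + c, r)
        ⟨hr, e + S.dF (m + 1) c, add_mem he (S.E_stable _ c hc), ?_⟩, ?_⟩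
      · change S.dF (m + 1) (a + c) = e + S.dF (m + 1) c - S.Ψ (m + 1 + 1) r
        rw [map_add, ← ha]; abel
      · refine QuotientAddGroup.eq.2 ((S'.mem_trivGroup_succ m _).2 ⟨b', -s', ?_, ?_⟩)
        · change -j (m + 1) (a + c) + a' = _
          rw [map_add, map_neg, eq_sub_of_add_eq' hb'.symm]; abel
        · change -ψ (m + 1 + 1) r + r' = _
          rw [map_neg, neg_neg, ← hs']; abel
  exact ⟨AddEquiv.ofBijective g hg, fun _ _ _ => rfl⟩
end

section
/- Let E^• ⊆ F^• be an inclusion of cochain complexes of abelian groups (concentrated in nonnegative degrees) which induces an isomorphism H^k(E) ≅ H^k(F) for every k. If a ∈ F^k satisfies da ∈ E^{k+1}, then there exist e ∈ E^k and b ∈ F^{k−1} such that a = e + db (with the convention F^{−1} = 0 when k = 0). -/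
universe u

/-- An inclusion of cochain complexes of abelian groups `E^• ⊆ F^•` (concentrated in
nonnegative degrees) inducing an isomorphism on cohomology in every degree. -/
structure SubcomplexPair where
  F : ℤ → Type u
  [instF : ∀ n, AddCommGroup (F n)]
  dF : ∀ n, F n →+ F (n + 1)
  E : ∀ n, AddSubgroup (F n)
  F_neg : ∀ n < 0, Subsingleton (F n)
  dF_sq : ∀ n (a : F n), dF (n + 1) (dF n a) = 0
  E_stable : ∀ n, ∀ a ∈ E n, dF n a ∈ E (n + 1)
  h_surj : ∀ n (a : F (n + 1)), dF (n + 1) a = 0 →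
    ∃ e ∈ E (n + 1), ∃ b : F n, a = e + dF n b
  h_inj : ∀ n (e : F (n + 1)), e ∈ E (n + 1) → dF (n + 1) e = 0 →
    (∃ b : F n, e = dF n b) → ∃ c ∈ E n, e = dF n c

attribute [instance] SubcomplexPair.instF

namespace SubcomplexPair

variable (S : SubcomplexPair)

/-- Transport along an equality of degrees. -/
def fcast {m n : ℤ} (h : m = n) : S.F m →+ S.F n := by subst h; exact AddMonoidHom.id _

/-- The differential written as a map `F^(k-1) → F^k`. -/
def dF' (k : ℤ) : S.F (k - 1) →+ S.F k := (S.fcast (by omega)).comp (S.dF (k - 1))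

end SubcomplexPair

/-- The shifted differential at `n + 1` agrees with `dF n` up to transport. -/
theorem SubcomplexPair.fcast_dF_fcast (S : SubcomplexPair) {m n : ℤ} (h : n = m)
    (h' : m + 1 = n + 1) (b : S.F n) :
    S.fcast h' (S.dF m (S.fcast h b)) = S.dF n b := by
  subst h
  rfl

/-- if the inclusion `E^• ⊆ F^•` induces an isomorphism on cohomology and
`a ∈ F^k` satisfies `da ∈ E^(k+1)`, then `a = e + db` with `e ∈ E^k` and `b ∈ F^(k-1)`. -/
theorem decomposition_lemma (S : SubcomplexPair) (k : ℤ) (a : S.F k)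
    (h : S.dF k a ∈ S.E (k + 1)) :
    ∃ e ∈ S.E k, ∃ b : S.F (k - 1), a = e + S.dF' k b := by
  obtain ⟨n, rfl⟩ : ∃ n, k = n + 1 := ⟨k - 1, by omega⟩
  obtain ⟨c, hc, hac⟩ := S.h_inj (n + 1) (S.dF (n + 1) a) h (S.dF_sq _ a) ⟨a, rfl⟩
  obtain ⟨e, he, b, hb⟩ := S.h_surj n (a - c) (by rw [map_sub, hac, sub_self])
  refine ⟨c + e, add_mem hc he, S.fcast (by omega) b, ?_⟩
  rw [SubcomplexPair.dF', AddMonoidHom.comp_apply, S.fcast_dF_fcast, add_assoc, ← hb,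
    add_sub_cancel]
end
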